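/- Fix an integer k ≥ 2 and a constant c₀ > 0, and assume the following supersaturation hypothesis: for every finite simple bipartite graph H with vertex bipartition A₀ ⊔ B₀ and m₀ edges satisfying m₀ ≥ 100·k·(|A₀| + |B₀| + (|A₀|·|B₀|)^((k+1)/(2k))), the number of copies of C_{2k} in H is at least c₀·m₀^(2k)/(|A₀|^k·|B₀|^k). Then there exist constants C > 0 and c > 0 (depending only on k and c₀) such that the following holds. Let G be a finite simple graph on n ≥ 2 vertices with m edges, containing t copies of C_{2k}, with maximum degree Δ(G) ≤ m^(2/(k+1)), and let ≻ be a linear order on V(G) such that deg(u) > deg(v) implies u ≻ v. Then the number of capped k-walks in G is at most C·(log₂ n)^c·(m^(2k/(k+1)) + t). -/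

import Mathlib

open SimpleGraph

/-- The number of subgraphs of `G` isomorphic to the cycle on `n` vertices. -/
noncomputable def countCopiesOfCycle (n : ℕ) {V : Type*} (G : SimpleGraph V) : ℕ :=
  {H : G.Subgraph | Nonempty (H.coe ≃g cycleGraph n)}.ncard

/-- The number of capped `k`-walks in `G` with respect to the strict order `r`. -/
noncomputable def cappedWalkCount {V : Type*} [Fintype V] (G : SimpleGraph V)
    (r : V → V → Prop) (k : ℕ) : ℕ :=
  {x : Fin (k + 1) → V | (∀ i : Fin k, G.Adj (x i.castSucc) (x i.succ)) ∧
    ∀ i : Fin k, r (x 0) (x i.succ)}.ncard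

/-- The unbalanced supersaturation hypothesis for `C_{2k}` with constant `c₀`. -/
def UnbalancedSupersat (k : ℕ) (c₀ : ℝ) : Prop :=
  ∀ (W : Type) [Fintype W] [DecidableEq W] (H : SimpleGraph W) [DecidableRel H.Adj]
    (A₀ B₀ : Finset W), Disjoint A₀ B₀ → A₀ ∪ B₀ = Finset.univ →
    (∀ u v : W, H.Adj u v → (u ∈ A₀ ∧ v ∈ B₀) ∨ (u ∈ B₀ ∧ v ∈ A₀)) →
    (H.edgeFinset.card : ℝ) ≥ 100 * k * ((A₀.card : ℝ) + (B₀.card : ℝ) +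
      ((A₀.card : ℝ) * (B₀.card : ℝ)) ^ (((k : ℝ) + 1) / (2 * (k : ℝ)))) →
    (countCopiesOfCycle (2 * k) H : ℝ) ≥
      c₀ * (H.edgeFinset.card : ℝ) ^ (2 * k) / ((A₀.card : ℝ) ^ k * (B₀.card : ℝ) ^ k)

theorem countCopiesOfCycle_le_of_copy {W V : Type*} [Finite V] {H : SimpleGraph W}
    {G : SimpleGraph V} (f : Copy H G) (n : ℕ) :
    countCopiesOfCycle n H ≤ countCopiesOfCycle n G := by
  classical
  have : Finite G.Subgraph := by
    have := Fintype.ofFinite V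
    infer_instance
  refine Set.ncard_le_ncard_of_injOn (Subgraph.map f.toHom) ?_ ?_ (Set.toFinite _)
  · rintro K ⟨e⟩
    exact ⟨(f.isoSubgraphMap K).symm.trans e⟩
  · intro K _ K' _ h
    have hf : Function.Injective f := f.injective
    ext u v
    · have := congrArg (fun S => f.toHom u ∈ S.verts) h
      simpa [hf.eq_iff] using this
    · have := congrArg (fun S => S.Adj (f.toHom u) (f.toHom v)) h
      simpa [Relation.map_apply, hf.eq_iff] using this

theorem mul_sqrt_card_rank_block_le {V : Type*} [Fintype V] (f : V → ℝ) (hf : ∀ u, 0 ≤ f u) (u : V)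
    (b : V → ℕ) (hb : ∀ u, b u = Nat.log 2 (Finset.univ.filter fun v => f u ≤ f v).card) :
    f u * √(Finset.univ.filter fun v => b v = b u).card ≤ √2 * √(∑ v, f v ^ 2) := by
  set S : V → Finset V := fun u => Finset.univ.filter fun v => f u ≤ f v with hS
  set A := Finset.univ.filter fun v => b v = b u with hA
  have hpos : ∀ u, (S u).card ≠ 0 := fun u =>
    Finset.card_ne_zero_of_mem (a := u) (by simp [S])
  have hAcard : A.card ≤ 2 * (S u).card := by
    obtain ⟨w, hwA, hw⟩ := A.exists_min_image f ⟨u, by simp [A]⟩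
    have h1 : A ⊆ S w := fun v hv => by simpa [S] using hw v hv
    have hwu : b w = b u := by simpa [A] using hwA
    have h2 : (S w).card < 2 ^ (b u + 1) := by
      rw [← hwu, hb]; exact Nat.lt_pow_succ_log_self (by norm_num) _
    have h3 : 2 ^ b u ≤ (S u).card := by
      rw [hb]; exact Nat.pow_log_le_self 2 (hpos u)
    have h4 := Finset.card_le_card h1
    rw [pow_succ] at h2
    omega
  have hsum : f u ^ 2 * (S u).card ≤ ∑ v, f v ^ 2 := by
    calc f u ^ 2 * (S u).card = ∑ v ∈ S u, f u ^ 2 := by simp [mul_comm]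
      _ ≤ ∑ v ∈ S u, f v ^ 2 := Finset.sum_le_sum fun v hv =>
          pow_le_pow_left₀ (hf u) (by simpa [S] using hv) 2
      _ ≤ _ := Finset.sum_le_univ_sum_of_nonneg fun v => sq_nonneg _
  rw [← Real.sqrt_mul (by norm_num)]
  apply Real.le_sqrt_of_sq_le
  rw [mul_pow, Real.sq_sqrt (by positivity)]
  have : (A.card : ℝ) ≤ 2 * (S u).card := by exact_mod_cast hAcard
  nlinarith [mul_le_mul_of_nonneg_left this (sq_nonneg (f u))]

theorem sum_mul_mul_le_of_cut_bound {V : Type*} [Fintype V] (w : V → V → ℝ)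
    (hw : ∀ u v, 0 ≤ w u v) (l : ℝ) (hl : 0 ≤ l)
    (hcut : ∀ A B : Finset V, ∑ u ∈ A, ∑ v ∈ B, w u v ≤ l * (√A.card * √B.card))
    (f g : V → ℝ) (hf : ∀ u, 0 ≤ f u) (hg : ∀ u, 0 ≤ g u) :
    ∑ u, ∑ v, f u * (w u v * g v) ≤
      2 * (Nat.log 2 (Fintype.card V) + 1 : ℕ) ^ 2 * l *
        (√(∑ v, f v ^ 2) * √(∑ v, g v ^ 2)) := by
  set L := Nat.log 2 (Fintype.card V) + 1
  set F := √(∑ v, f v ^ 2)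
  set H := √(∑ v, g v ^ 2)
  set b : V → ℕ := fun u => Nat.log 2 (Finset.univ.filter fun v => f u ≤ f v).card with hb
  set c : V → ℕ := fun u => Nat.log 2 (Finset.univ.filter fun v => g u ≤ g v).card with hc
  have hbL : ∀ u ∈ Finset.univ, b u ∈ Finset.range L := fun u _ =>
    Finset.mem_range.2 (Nat.lt_succ_of_le (Nat.log_mono_right (Finset.card_le_univ _)))
  have hcL : ∀ u ∈ Finset.univ, c u ∈ Finset.range L := fun u _ =>
    Finset.mem_range.2 (Nat.lt_succ_of_le (Nat.log_mono_right (Finset.card_le_univ _)))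
  have key : ∀ i j : ℕ, ∑ u with b u = i, ∑ v with c v = j, f u * (w u v * g v) ≤
      2 * l * (F * H) := by
    intro i j
    have hF : ∀ u ∈ Finset.univ.filter (fun u => b u = i),
        f u ≤ √2 * F / √(Finset.univ.filter (fun u => b u = i)).card := by
      intro u hu
      have hc0 := Finset.card_pos.2 ⟨u, hu⟩
      rw [le_div_iff₀ (by positivity)]
      obtain rfl : b u = i := by simpa using hu
      exact mul_sqrt_card_rank_block_le f hf u b fun _ => rfl
    have hG : ∀ u ∈ Finset.univ.filter (fun u => c u = j),
        g u ≤ √2 * H / √(Finset.univ.filter (fun u => c u = j)).card := by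
      intro u hu
      have hc0 := Finset.card_pos.2 ⟨u, hu⟩
      rw [le_div_iff₀ (by positivity)]
      obtain rfl : c u = j := by simpa using hu
      exact mul_sqrt_card_rank_block_le g hg u c fun _ => rfl
    set A := Finset.univ.filter (fun u => b u = i)
    set B := Finset.univ.filter (fun u => c u = j)
    have hR : 0 ≤ 2 * l * (F * H) := by positivity
    rcases A.eq_empty_or_nonempty with hA | hA
    · simpa [hA] using hR
    rcases B.eq_empty_or_nonempty with hB | hB
    · simpa [hB] using hR
    have hA' : 0 < √(A.card : ℝ) := by have := hA.card_pos; positivity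
    have hB' : 0 < √(B.card : ℝ) := by have := hB.card_pos; positivity
    calc ∑ u ∈ A, ∑ v ∈ B, f u * (w u v * g v)
        ≤ ∑ u ∈ A, ∑ v ∈ B, √2 * F / √A.card * (w u v * (√2 * H / √B.card)) := by
          refine Finset.sum_le_sum fun u hu => Finset.sum_le_sum fun v hv => ?_
          have := hF u hu
          have := hG v hv
          have := hw u v
          have := hg v
          gcongr
      _ = √2 * F / √A.card * (√2 * H / √B.card) * ∑ u ∈ A, ∑ v ∈ B, w u v := by
          simp only [Finset.mul_sum]
          refine Finset.sum_congr rfl fun u _ => Finset.sum_congr rfl fun v _ => by ring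
      _ ≤ √2 * F / √A.card * (√2 * H / √B.card) * (l * (√A.card * √B.card)) :=
          mul_le_mul_of_nonneg_left (hcut A B) (by positivity)
      _ = (√2 * √2) * l * (F * H) := by field_simp
      _ = 2 * l * (F * H) := by rw [Real.mul_self_sqrt (by norm_num)]
  calc ∑ u, ∑ v, f u * (w u v * g v)
      = ∑ i ∈ Finset.range L, ∑ j ∈ Finset.range L,
          ∑ u with b u = i, ∑ v with c v = j, f u * (w u v * g v) := by
        rw [← Finset.sum_fiberwise_of_maps_to hbL]
        refine Finset.sum_congr rfl fun i _ => ?_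
        refine Eq.trans ?_ Finset.sum_comm
        exact Finset.sum_congr rfl fun u _ => (Finset.sum_fiberwise_of_maps_to hcL _).symm
    _ ≤ ∑ i ∈ Finset.range L, ∑ j ∈ Finset.range L, 2 * l * (F * H) :=
        Finset.sum_le_sum fun i _ => Finset.sum_le_sum fun j _ => key i j
    _ = _ := by simp only [Finset.sum_const, Finset.card_range, nsmul_eq_mul]; ring

theorem sum_pi_fin_succ_last {V M : Type*} [Fintype V] [AddCommMonoid M] (n : ℕ)
    (Φ : (Fin (n + 1) → V) → M) :
    ∑ x, Φ x = ∑ y : Fin n → V, ∑ v, Φ (Fin.snoc y v) := by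
  rw [← (Fin.snocEquiv fun _ : Fin (n + 1) => V).sum_comp, Fintype.sum_prod_type_right]
  rfl

theorem forall_adj_snoc_iff {V : Type*} (G : SimpleGraph V) {n : ℕ} (y : Fin (n + 1) → V) (v : V) :
    (∀ i : Fin (n + 1), G.Adj ((Fin.snoc y v : Fin (n + 2) → V) i.castSucc)
      ((Fin.snoc y v : Fin (n + 2) → V) i.succ)) ↔
      (∀ i : Fin n, G.Adj (y i.castSucc) (y i.succ)) ∧ G.Adj (y (Fin.last n)) v := by
  rw [Fin.forall_fin_succ']
  simp only [Fin.snoc_castSucc, ← Fin.castSucc_succ, Fin.succ_last, Fin.snoc_last]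

/-- The action of the adjacency operator of `G` on real functions. -/
noncomputable def neighborSum {V : Type*} [Fintype V] (G : SimpleGraph V) [DecidableRel G.Adj]
    (g : V → ℝ) (u : V) : ℝ :=
  ∑ v, if G.Adj u v then g v else 0

theorem neighborSum_nonneg {V : Type*} [Fintype V] (G : SimpleGraph V) [DecidableRel G.Adj]
    {g : V → ℝ} (hg : ∀ u, 0 ≤ g u) (u : V) : 0 ≤ neighborSum G g u :=
  Finset.sum_nonneg fun v _ => by split_ifs <;> simp [hg]

theorem sum_walks_eq_sum_iterate_neighborSum {V : Type*} [Fintype V] (G : SimpleGraph V)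
    [DecidableRel G.Adj] (F : V → ℝ) (n : ℕ) (g : V → ℝ) :
    (∑ x : Fin (n + 1) → V, if ∀ i : Fin n, G.Adj (x i.castSucc) (x i.succ) then
      F (x 0) * g (x (Fin.last n)) else 0) = ∑ u, F u * (neighborSum G)^[n] g u := by
  induction n generalizing g with
  | zero =>
    rw [← (Equiv.funUnique (Fin 1) V).symm.sum_comp]
    simp
  | succ n ih =>
    rw [sum_pi_fin_succ_last, Function.iterate_succ_apply, ← ih]
    refine Finset.sum_congr rfl fun y _ => ?_
    simp only [forall_adj_snoc_iff, Fin.snoc_last]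
    have h0 : ∀ v, (Fin.snoc y v : Fin (n + 2) → V) 0 = y 0 := fun v => by
      rw [← Fin.castSucc_zero, Fin.snoc_castSucc]
    simp only [h0, neighborSum]
    split_ifs with h
    · rw [Finset.mul_sum]
      refine Finset.sum_congr rfl fun v _ => ?_
      simp [h]
    · simp [h]

theorem sum_mul_iterate_neighborSum_le {V : Type*} [Fintype V] (G : SimpleGraph V)
    [DecidableRel G.Adj] (l : ℝ) (hl : 0 ≤ l)
    (h : ∀ f g : V → ℝ, (∀ u, 0 ≤ f u) → (∀ u, 0 ≤ g u) →
      ∑ u, f u * neighborSum G g u ≤ l * (√(∑ v, f v ^ 2) * √(∑ v, g v ^ 2)))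
    (f g : V → ℝ) (hg : ∀ u, 0 ≤ g u) (n : ℕ) :
    ∑ u, f u * (neighborSum G)^[n] g u ≤ l ^ n * (√(∑ v, f v ^ 2) * √(∑ v, g v ^ 2)) := by
  have hn : ∀ n, (∀ u, 0 ≤ (neighborSum G)^[n] g u) ∧
      √(∑ v, (neighborSum G)^[n] g v ^ 2) ≤ l ^ n * √(∑ v, g v ^ 2) := by
    intro n
    induction n with
    | zero => simpa using hg
    | succ n ih =>
      rw [Function.iterate_succ_apply']
      set q := (neighborSum G)^[n] g
      have h0 := neighborSum_nonneg G ih.1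
      refine ⟨h0, ?_⟩
      have h1 : √(∑ v, neighborSum G q v ^ 2) ≤ l * √(∑ v, q v ^ 2) := by
        rcases (Real.sqrt_nonneg (∑ v, neighborSum G q v ^ 2)).eq_or_lt with hz | hz
        · rw [← hz]; positivity
        · have := h _ q h0 ih.1
          simp only [← pow_two] at this
          rw [← Real.mul_self_sqrt (Finset.sum_nonneg fun v _ => sq_nonneg _)] at this
          refine le_of_mul_le_mul_left (this.trans_eq ?_) hz
          simp only [← pow_two, Real.sqrt_sq hz.le]
          ring
      calc _ ≤ l * √(∑ v, q v ^ 2) := h1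
        _ ≤ l * (l ^ n * √(∑ v, g v ^ 2)) := mul_le_mul_of_nonneg_left ih.2 hl
        _ = _ := by ring
  calc ∑ u, f u * (neighborSum G)^[n] g u
      ≤ √(∑ v, f v ^ 2) * √(∑ v, (neighborSum G)^[n] g v ^ 2) :=
        Real.sum_mul_le_sqrt_mul_sqrt _ _ _
    _ ≤ √(∑ v, f v ^ 2) * (l ^ n * √(∑ v, g v ^ 2)) :=
        mul_le_mul_of_nonneg_left (hn n).2 (Real.sqrt_nonneg _)
    _ = _ := by ring

theorem cappedWalkCount_le_sum {V : Type*} [Fintype V] (G : SimpleGraph V) [DecidableRel G.Adj]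
    (r : V → V → Prop) [IsStrictTotalOrder V r]
    (hr : ∀ u v : V, G.degree u > G.degree v → r u v) (n : ℕ) :
    (cappedWalkCount G r (n + 1) : ℝ) ≤
      ∑ u, √(G.degree u) * (neighborSum G)^[n] (fun v => √(G.degree v)) u := by
  classical
  have hle : ∀ u v, r u v → G.degree v ≤ G.degree u := fun u v h => by
    by_contra! h'
    exact asymm_of r h (hr v u h')
  rw [cappedWalkCount, Set.ncard_eq_toFinset_card', Set.toFinset_ofPred, Finset.card_filter,
    sum_pi_fin_succ_last, ← sum_walks_eq_sum_iterate_neighborSum, Nat.cast_sum]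
  refine Finset.sum_le_sum fun y _ => ?_
  simp only [forall_adj_snoc_iff]
  have h0 : ∀ v, (Fin.snoc y v : Fin (n + 2) → V) 0 = y 0 := fun v => by
    rw [← Fin.castSucc_zero, Fin.snoc_castSucc]
  split_ifs with h
  · by_cases hd : G.degree (y (Fin.last n)) ≤ G.degree (y 0)
    · calc _ ≤ (G.degree (y (Fin.last n)) : ℝ) := by
            rw [← card_neighborFinset_eq_degree, ← Finset.card_filter, Nat.cast_le]
            refine Finset.card_le_card fun v hv => ?_
            simp only [Finset.mem_filter] at hv
            simpa using hv.2.1.2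
        _ = √(G.degree (y (Fin.last n))) * √(G.degree (y (Fin.last n))) :=
            (Real.mul_self_sqrt (by positivity)).symm
        _ ≤ _ := by gcongr
    · have : ∀ v, ¬ ∀ i : Fin (n + 1), r ((Fin.snoc y v : Fin (n + 2) → V) 0)
          ((Fin.snoc y v : Fin (n + 2) → V) i.succ) := by
        intro v hv
        rcases n with _ | n
        · exact hd le_rfl
        · have := hv (Fin.last n).castSucc
          rw [h0, Fin.succ_castSucc, Fin.snoc_castSucc, Fin.succ_last] at this
          exact hd (hle _ _ this)
      simp only [this, and_false, if_false, Finset.sum_const_zero, Nat.cast_zero]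
      positivity
  · simp [h]

theorem card_interedges_le_sum_degree {V : Type*} [Fintype V] [DecidableEq V] (G : SimpleGraph V)
    [DecidableRel G.Adj] (A B : Finset V) :
    (G.interedges A B).card ≤ ∑ u ∈ A, G.degree u := by
  rw [interedges_def, Finset.card_filter, Finset.sum_product]
  refine Finset.sum_le_sum fun u _ => ?_
  rw [← Finset.card_filter, ← card_neighborFinset_eq_degree]
  exact Finset.card_le_card fun v hv => by simpa using (Finset.mem_filter.1 hv).2

theorem card_interedges_le_mul_maxDegree {V : Type*} [Fintype V] [DecidableEq V]
    (G : SimpleGraph V) [DecidableRel G.Adj] (A B : Finset V) :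
    (G.interedges A B).card ≤ A.card * G.maxDegree :=
  (card_interedges_le_sum_degree G A B).trans
    (Finset.sum_le_card_nsmul _ _ _ fun u _ => G.degree_le_maxDegree u)

theorem card_interedges_le_two_mul {V : Type*} [Fintype V] [DecidableEq V] (G : SimpleGraph V)
    [DecidableRel G.Adj] (A B : Finset V) :
    (G.interedges A B).card ≤ 2 * G.edgeFinset.card := by
  rw [← G.sum_degrees_eq_twice_card_edges]
  exact (card_interedges_le_sum_degree G A B).trans
    (Finset.sum_le_sum_of_subset (Finset.subset_univ A))

theorem UnbalancedSupersat.le_countCopiesOfCycle {k : ℕ} {c₀ : ℝ} (hc₀ : 0 < c₀)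
    (hyp : UnbalancedSupersat k c₀) {V : Type} [Fintype V] [DecidableEq V] (G : SimpleGraph V)
    [DecidableRel G.Adj] (A B : Finset V) (hAB : Disjoint A B)
    (h : ((G.interedges A B).card : ℝ) ≥ 100 * k * ((A.card : ℝ) + (B.card : ℝ) +
      ((A.card : ℝ) * (B.card : ℝ)) ^ (((k : ℝ) + 1) / (2 * (k : ℝ))))) :
    c₀ * ((G.interedges A B).card : ℝ) ^ (2 * k) / ((A.card : ℝ) ^ k * (B.card : ℝ) ^ k) ≤
      countCopiesOfCycle (2 * k) G := by
  let H : SimpleGraph {v // v ∈ A ∪ B} :=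
    { Adj := fun u v => G.Adj u v ∧ ((u.1 ∈ A ∧ v.1 ∈ B) ∨ (u.1 ∈ B ∧ v.1 ∈ A))
      symm := ⟨fun u v h => ⟨h.1.symm, h.2.symm.imp And.symm And.symm⟩⟩
      loopless := ⟨fun u h => G.loopless.irrefl _ h.1⟩ }
  have hHdec : DecidableRel H.Adj := fun u v => by
    change Decidable (_ ∧ _)
    infer_instance
  let f : Copy H G := ⟨⟨Subtype.val, fun h => h.1⟩, Subtype.val_injective⟩
  set A₀ : Finset {v // v ∈ A ∪ B} := A.subtype _ with hA₀
  set B₀ : Finset {v // v ∈ A ∪ B} := B.subtype _ with hB₀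
  have hA : A₀.card = A.card := by
    rw [Finset.card_subtype, Finset.filter_true_of_mem fun x hx => Finset.mem_union_left _ hx]
  have hB : B₀.card = B.card := by
    rw [Finset.card_subtype, Finset.filter_true_of_mem fun x hx => Finset.mem_union_right _ hx]
  have hle : (G.interedges A B).card ≤ H.edgeFinset.card := by
    have hinj : Set.InjOn (fun p : V × V => s(p.1, p.2)) (G.interedges A B) := by
      rintro ⟨a, b⟩ h1 ⟨a', b'⟩ h2 h3
      simp only [Finset.mem_coe, mem_interedges_iff] at h1 h2
      rcases Sym2.eq_iff.1 h3 with ⟨h4, h5⟩ | ⟨h4, h5⟩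
      · exact Prod.ext h4 h5
      · simp only at h4 h5
        subst h4
        exact absurd h2.2.1 (Finset.disjoint_left.1 hAB h1.1)
    rw [← Finset.card_image_of_injOn hinj]
    refine (Finset.card_le_card ?_).trans
      (Finset.card_image_le (s := H.edgeFinset) (f := Sym2.map Subtype.val))
    intro e he
    obtain ⟨⟨a, b⟩, hab, rfl⟩ := Finset.mem_image.1 he
    rw [mem_interedges_iff] at hab
    exact Finset.mem_image.2 ⟨s(⟨a, Finset.mem_union_left _ hab.1⟩,
      ⟨b, Finset.mem_union_right _ hab.2.1⟩),
      by rw [mem_edgeFinset]; exact ⟨hab.2.2, Or.inl ⟨hab.1, hab.2.1⟩⟩, rfl⟩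
  have hle' : ((G.interedges A B).card : ℝ) ≤ H.edgeFinset.card := by exact_mod_cast hle
  have key := hyp _ H A₀ B₀
    (by
      rw [Finset.disjoint_left]
      intro x hx hx'
      rw [Finset.mem_subtype] at hx hx'
      exact Finset.disjoint_left.1 hAB hx hx')
    (by
      ext x
      simp only [Finset.mem_union, Finset.mem_subtype, Finset.mem_univ, iff_true, A₀, B₀]
      exact Finset.mem_union.1 x.2)
    (fun u v huv => by
      simpa [A₀, B₀] using huv.2)
    (by rw [hA, hB]; exact le_trans h hle')
  rw [hA, hB] at key
  have hcopy : (countCopiesOfCycle (2 * k) H : ℝ) ≤ countCopiesOfCycle (2 * k) G := by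
    exact_mod_cast countCopiesOfCycle_le_of_copy f (2 * k)
  refine (key.trans' ?_).trans hcopy
  gcongr

theorem sq_rpow_le_mul_of_le_pow {k : ℕ} (hk : k ≠ 0) {s M : ℝ} (hs : 0 ≤ s) (hM : 0 ≤ M)
    (h : s ≤ M ^ k) : (s ^ 2) ^ (((k : ℝ) + 1) / (2 * (k : ℝ))) ≤ M * s := by
  have hk0 : (k : ℝ) ≠ 0 := by exact_mod_cast hk
  calc (s ^ 2) ^ (((k : ℝ) + 1) / (2 * (k : ℝ))) = s ^ (1 + (k : ℝ)⁻¹) := by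
        rw [← Real.rpow_natCast s 2, ← Real.rpow_mul hs]
        congr 1
        push_cast
        field_simp
    _ = s * s ^ (k : ℝ)⁻¹ := by
        rw [Real.rpow_add_of_nonneg hs (by norm_num) (by positivity), Real.rpow_one]
    _ ≤ s * (M ^ k) ^ (k : ℝ)⁻¹ := by gcongr
    _ = s * M := by rw [Real.pow_rpow_inv_natCast hM hk]
    _ = M * s := mul_comm _ _

theorem card_interedges_le_of_disjoint {k : ℕ} (hk : 2 ≤ k) {c₀ : ℝ} (hc₀ : 0 < c₀)
    (hyp : UnbalancedSupersat k c₀) {V : Type} [Fintype V] [DecidableEq V] (G : SimpleGraph V)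
    [DecidableRel G.Adj] {M T q : ℝ} (hM : 0 ≤ M) (hT : 0 ≤ T) (hq : 0 ≤ q)
    (hqc : q ^ (2 * k) * c₀ = 1) (hMm : M ^ (k + 1) = G.edgeFinset.card)
    (hdeg : (G.maxDegree : ℝ) ≤ M ^ 2) (hTt : T ^ (2 * k) = countCopiesOfCycle (2 * k) G)
    (A B : Finset V) (hAB : Disjoint A B) :
    ((G.interedges A B).card : ℝ) ≤ (300 * k + q) * (M + T) * (√A.card * √B.card) := by
  have hk2 : (2 : ℝ) ≤ k := by exact_mod_cast hk
  have hA0 : (0 : ℝ) ≤ A.card := Nat.cast_nonneg _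
  have hB0 : (0 : ℝ) ≤ B.card := Nat.cast_nonneg _
  set e : ℝ := ((G.interedges A B).card : ℝ) with he
  have he0 : 0 ≤ e := Nat.cast_nonneg _
  have hedA : e ≤ M ^ 2 * A.card := by
    have h1 : e ≤ A.card * G.maxDegree := by
      rw [he]; exact_mod_cast card_interedges_le_mul_maxDegree G A B
    nlinarith
  have hedB : e ≤ M ^ 2 * B.card := by
    have h1 : e ≤ B.card * G.maxDegree := by
      have : Std.Symm G.Adj := ⟨fun _ _ h => h.symm⟩
      rw [he, interedges, Rel.card_interedges_comm]
      exact_mod_cast card_interedges_le_mul_maxDegree G B A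
    nlinarith
  have hem : e ≤ 2 * M ^ (k + 1) := by
    rw [hMm, he]; exact_mod_cast card_interedges_le_two_mul G A B
  set s : ℝ := √A.card * √B.card with hs
  have hs0 : 0 ≤ s := by positivity
  have hs2 : s ^ 2 = A.card * B.card := by
    rw [hs, mul_pow, Real.sq_sqrt hA0, Real.sq_sqrt hB0]
  suffices h : e ≤ 300 * k * (M * s) ∨ e ≤ q * (T * s) by
    have h1 : 0 ≤ 300 * k * (T * s) := by positivity
    have h2 : 0 ≤ 300 * k * (M * s) := by positivity
    have h3 : 0 ≤ q * (T * s) := by positivity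
    have h4 : 0 ≤ q * (M * s) := by positivity
    rcases h with h | h <;> nlinarith
  by_cases hcase : e ≥ 100 * k * ((A.card : ℝ) + (B.card : ℝ) +
      ((A.card : ℝ) * (B.card : ℝ)) ^ (((k : ℝ) + 1) / (2 * (k : ℝ))))
  · right
    have h1 := hyp.le_countCopiesOfCycle hc₀ G A B hAB hcase
    rw [← he, ← hTt, ← mul_pow, ← hs2, ← pow_mul] at h1
    rcases hs0.eq_or_lt with hz | hz
    · have : (A.card : ℝ) * B.card = 0 := by rw [← hs2, ← hz]; ring
      have : e = 0 := by
        rcases mul_eq_zero.1 this with h | h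
        · rw [h] at hedA; linarith
        · rw [h] at hedB; linarith
      rw [this]; positivity
    · rw [div_le_iff₀ (by positivity)] at h1
      refine le_of_pow_le_pow_left₀ (n := 2 * k) (by omega) (by positivity) ?_
      calc e ^ (2 * k) = q ^ (2 * k) * (c₀ * e ^ (2 * k)) := by rw [← mul_assoc, hqc, one_mul]
        _ ≤ q ^ (2 * k) * (T ^ (2 * k) * s ^ (2 * k)) := by gcongr
        _ = (q * (T * s)) ^ (2 * k) := by ring
  · left
    push Not at hcase
    set p := ((A.card : ℝ) * (B.card : ℝ)) ^ (((k : ℝ) + 1) / (2 * (k : ℝ))) with hp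
    have hsq : ∀ x : ℝ, 0 ≤ x → e ≤ 300 * k * x → x * e ≤ 300 * k * (M * s) ^ 2 →
        e ≤ 300 * k * (M * s) := by
      intro x hx h1 h2
      refine le_of_pow_le_pow_left₀ (n := 2) (by norm_num) (by positivity) ?_
      calc e ^ 2 = e * e := by ring
        _ ≤ 300 * k * x * e := by gcongr
        _ = 300 * k * (x * e) := by ring
        _ ≤ 300 * k * (300 * k * (M * s) ^ 2) := by gcongr
        _ = _ := by ring
    have hMs : (M * s) ^ 2 ≤ 300 * k * (M * s) ^ 2 :=
      le_mul_of_one_le_left (by positivity) (by linarith)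
    have h3 : e ≤ 300 * k * A.card ∨ e ≤ 300 * k * B.card ∨ e ≤ 300 * k * p := by
      by_contra! hcon
      obtain ⟨h5, h6, h7⟩ := hcon
      linarith
    rcases h3 with h | h | h
    · refine hsq _ hA0 h (hMs.trans' ?_)
      rw [mul_pow, hs2]
      nlinarith
    · refine hsq _ hB0 h (hMs.trans' ?_)
      rw [mul_pow, hs2]
      nlinarith
    · rcases le_total s (M ^ k) with h4 | h4
      · refine h.trans (mul_le_mul_of_nonneg_left ?_ (by positivity))
        rw [hp, ← hs2]
        exact sq_rpow_le_mul_of_le_pow (by omega) hs0 hM h4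
      · calc e ≤ 2 * M ^ (k + 1) := hem
          _ = 2 * (M * M ^ k) := by ring
          _ ≤ 2 * (M * s) := by gcongr
          _ ≤ 300 * k * (M * s) := by gcongr; linarith

theorem card_interedges_le_of_forall_disjoint {V : Type*} [Fintype V] [DecidableEq V]
    (G : SimpleGraph V) [DecidableRel G.Adj] {l : ℝ} (hl : 0 ≤ l)
    (h : ∀ A B : Finset V, Disjoint A B →
      ((G.interedges A B).card : ℝ) ≤ l * (√A.card * √B.card)) (A B : Finset V) :
    ((G.interedges A B).card : ℝ) ≤
      2 * (Nat.log 2 (Fintype.card V) + 1 : ℕ) * l * (√A.card * √B.card) := by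
  set L := Nat.log 2 (Fintype.card V) + 1
  set b : ℕ → V → Bool := fun i v => (Fintype.equivFin V v : ℕ).testBit i with hb
  set P : ℕ × Bool → Finset (V × V) := fun p =>
    G.interedges (A.filter fun v => b p.1 v = p.2) (B.filter fun v => b p.1 v ≠ p.2) with hP
  have hsub : G.interedges A B ⊆ (Finset.range L ×ˢ Finset.univ).biUnion P := by
    rintro ⟨u, v⟩ huv
    rw [mem_interedges_iff] at huv
    have hne : (Fintype.equivFin V u : ℕ) ≠ Fintype.equivFin V v := fun h' =>
      huv.2.2.ne ((Fintype.equivFin V).injective (Fin.ext h'))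
    obtain ⟨i, hi⟩ := Nat.exists_testBit_ne_of_ne hne
    have hiL : i < L := by
      by_contra! hLi
      have hlt : ∀ w : V, (Fintype.equivFin V w : ℕ) < 2 ^ i := fun w =>
        (Fintype.equivFin V w).2.trans ((Nat.lt_pow_succ_log_self (by norm_num) _).trans_le
          (Nat.pow_le_pow_right (by norm_num) hLi))
      exact hi (by rw [Nat.testBit_lt_two_pow (hlt u), Nat.testBit_lt_two_pow (hlt v)])
    refine Finset.mem_biUnion.2 ⟨(i, b i u), by simpa using hiL, ?_⟩
    rw [mem_interedges_iff]
    simp only [Finset.mem_filter]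
    exact ⟨⟨huv.1, trivial⟩, ⟨huv.2.1, hi.symm⟩, huv.2.2⟩
  have hPle : ∀ p, ((P p).card : ℝ) ≤ l * (√A.card * √B.card) := by
    intro p
    refine (h _ _ ?_).trans ?_
    · rw [Finset.disjoint_left]
      intro x hx hx'
      exact (Finset.mem_filter.1 hx').2 (Finset.mem_filter.1 hx).2
    · gcongr <;> exact Finset.filter_subset _ _
  calc ((G.interedges A B).card : ℝ)
      ≤ ∑ p ∈ Finset.range L ×ˢ (Finset.univ : Finset Bool), ((P p).card : ℝ) := by
        exact_mod_cast (Finset.card_le_card hsub).trans Finset.card_biUnion_le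
    _ ≤ ∑ p ∈ Finset.range L ×ˢ (Finset.univ : Finset Bool), l * (√A.card * √B.card) :=
        Finset.sum_le_sum fun p _ => hPle p
    _ = _ := by
        simp only [Finset.sum_const, Finset.card_product, Finset.card_range, Finset.card_univ,
          Fintype.card_bool, nsmul_eq_mul]
        push_cast
        ring

/-- Under the unbalanced supersaturation hypothesis, if `Δ(G) ≤ m^(2/(k+1))` then the
number of capped `k`-walks in `G` is at most `C·(log₂ n)^c·(m^(2k/(k+1)) + t)`. -/
theorem capped_walks_bound_of_supersat (k : ℕ) (hk : 2 ≤ k) (c₀ : ℝ) (hc₀ : 0 < c₀)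
    (hyp : UnbalancedSupersat k c₀) :
    ∃ C c : ℝ, 0 < C ∧ 0 < c ∧
      ∀ (V : Type) [Fintype V] [DecidableEq V] (G : SimpleGraph V) [DecidableRel G.Adj]
        (r : V → V → Prop), IsStrictTotalOrder V r →
        (∀ u v : V, G.degree u > G.degree v → r u v) →
        2 ≤ Fintype.card V →
        (G.maxDegree : ℝ) ≤ (G.edgeFinset.card : ℝ) ^ (2 / ((k : ℝ) + 1)) →
        (cappedWalkCount G r k : ℝ) ≤
          C * (Real.logb 2 (Fintype.card V)) ^ c *
            ((G.edgeFinset.card : ℝ) ^ (2 * (k : ℝ) / ((k : ℝ) + 1)) +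
              (countCopiesOfCycle (2 * k) G : ℝ)) := by
  obtain ⟨n, hkn⟩ : ∃ n, k = n + 1 := ⟨k - 1, by omega⟩
  set q : ℝ := (1 / c₀) ^ ((2 * k : ℕ) : ℝ)⁻¹ with hq
  have hq0 : 0 < q := by positivity
  have hqc : q ^ (2 * k) * c₀ = 1 := by
    rw [hq, Real.rpow_inv_natCast_pow (by positivity) (by omega)]
    field_simp
  set K : ℝ := 300 * k + q with hK
  have hK0 : 0 < K := by positivity
  have hn1 : 1 ≤ n := by omega
  refine ⟨2 * (64 * K) ^ n, ((3 * n : ℕ) : ℝ), by positivity, by positivity, ?_⟩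
  intro V _ _ G _ r hr hdegr hV hΔ
  set m : ℝ := (G.edgeFinset.card : ℝ) with hm
  have hm0 : 0 ≤ m := Nat.cast_nonneg _
  set t : ℝ := (countCopiesOfCycle (2 * k) G : ℝ) with ht
  have ht0 : 0 ≤ t := Nat.cast_nonneg _
  set M : ℝ := m ^ ((k + 1 : ℕ) : ℝ)⁻¹ with hM
  set T : ℝ := t ^ ((2 * k : ℕ) : ℝ)⁻¹ with hT
  have hM0 : 0 ≤ M := by positivity
  have hT0 : 0 ≤ T := by positivity
  have hMm : M ^ (k + 1) = m := Real.rpow_inv_natCast_pow hm0 (by omega)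
  have hTt : T ^ (2 * k) = t := Real.rpow_inv_natCast_pow ht0 (by omega)
  have hMpow : ∀ a : ℕ, M ^ a = m ^ ((a : ℝ) / ((k : ℝ) + 1)) := fun a => by
    rw [hM, ← Real.rpow_mul_natCast hm0]
    congr 1
    push_cast
    field_simp
  have hΔM : (G.maxDegree : ℝ) ≤ M ^ 2 := by
    rw [hMpow]; exact_mod_cast hΔ
  have hMk : m ^ (2 * (k : ℝ) / ((k : ℝ) + 1)) = M ^ (2 * k) := by
    rw [hMpow]; push_cast; rfl
  set ℓ := Real.logb 2 (Fintype.card V) with hℓ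
  have hV' : (2 : ℝ) ≤ Fintype.card V := by exact_mod_cast hV
  have hℓ1 : 1 ≤ ℓ := by
    rw [hℓ, Real.le_logb_iff_rpow_le (by norm_num) (by linarith)]
    simpa using hV'
  set L : ℕ := Nat.log 2 (Fintype.card V) + 1 with hL
  have hLℓ : (L : ℝ) ≤ 2 * ℓ := by
    have := Real.natLog_le_logb (Fintype.card V) 2
    rw [hL]; push_cast at this ⊢
    linarith
  set l₁ : ℝ := 2 * L * (K * (M + T)) with hl₁
  have hl₁0 : 0 ≤ l₁ := by positivity
  have hcut := card_interedges_le_of_forall_disjoint G (l := K * (M + T)) (by positivity)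
    (card_interedges_le_of_disjoint hk hc₀ hyp G hM0 hT0 hq0.le hqc hMm hΔM hTt)
  set l : ℝ := 2 * (L : ℝ) ^ 2 * l₁ with hl
  have hl0 : 0 ≤ l := by positivity
  have hbil : ∀ f g : V → ℝ, (∀ u, 0 ≤ f u) → (∀ u, 0 ≤ g u) →
      ∑ u, f u * neighborSum G g u ≤ l * (√(∑ v, f v ^ 2) * √(∑ v, g v ^ 2)) := by
    intro f g hf hg
    have := sum_mul_mul_le_of_cut_bound (fun u v => if G.Adj u v then (1 : ℝ) else 0)
      (fun u v => by split_ifs <;> norm_num) l₁ hl₁0 (fun A B => by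
        refine (hcut A B).trans' (le_of_eq ?_)
        rw [interedges_def, Finset.card_filter, Finset.sum_product]
        push_cast
        rfl) f g hf hg
    refine this.trans' (le_of_eq ?_)
    simp [neighborSum, Finset.mul_sum]
  have hdegsum : √(∑ v, √(G.degree v : ℝ) ^ 2) * √(∑ v, √(G.degree v : ℝ) ^ 2) = 2 * m := by
    rw [Real.mul_self_sqrt (Finset.sum_nonneg fun _ _ => sq_nonneg _)]
    simp only [Real.sq_sqrt (Nat.cast_nonneg _)]
    rw [hm]
    exact_mod_cast G.sum_degrees_eq_twice_card_edges
  have hll : l ≤ 64 * K * ℓ ^ 3 * max M T := by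
    have h1 : (L : ℝ) ^ 3 ≤ (2 * ℓ) ^ 3 := by gcongr
    have h2 : M + T ≤ 2 * max M T := by
      linarith [le_max_left M T, le_max_right M T]
    calc l = 4 * K * (L : ℝ) ^ 3 * (M + T) := by rw [hl, hl₁]; ring
      _ ≤ 4 * K * (2 * ℓ) ^ 3 * (2 * max M T) := by gcongr
      _ = _ := by ring
  have hX0 : 0 ≤ max M T := le_max_of_le_left hM0
  have hX : max M T ^ (2 * k) ≤ M ^ (2 * k) + T ^ (2 * k) := by
    rcases max_choice M T with h | h <;> rw [h] <;> simp <;> positivity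
  have hXpow : max M T ^ (k + 1) * max M T ^ n = max M T ^ (2 * k) := by
    rw [← pow_add]; congr 1; omega
  clear_value K q M T ℓ l
  have hwalk : (cappedWalkCount G r k : ℝ) ≤ 2 * (M ^ (k + 1) * l ^ n) := by
    have h1 := cappedWalkCount_le_sum G r hdegr n
    have h2 := sum_mul_iterate_neighborSum_le G l hl0 hbil (fun v => √(G.degree v))
      (fun v => √(G.degree v)) (fun _ => Real.sqrt_nonneg _) n
    rw [hdegsum] at h2
    rw [hMm]
    calc (cappedWalkCount G r k : ℝ) ≤ _ := hkn ▸ h1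
      _ ≤ _ := h2
      _ = _ := by ring
  have hfin : M ^ (k + 1) * l ^ n ≤ max M T ^ (k + 1) * (64 * K * ℓ ^ 3 * max M T) ^ n :=
    mul_le_mul (pow_le_pow_left₀ hM0 (le_max_left _ _) _) (pow_le_pow_left₀ hl0 hll n)
      (by positivity) (by positivity)
  rw [hMk, Real.rpow_natCast, ← hTt]
  calc (cappedWalkCount G r k : ℝ)
      ≤ 2 * (max M T ^ (k + 1) * (64 * K * ℓ ^ 3 * max M T) ^ n) :=
        hwalk.trans (mul_le_mul_of_nonneg_left hfin (by norm_num))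
    _ = 2 * (64 * K) ^ n * ℓ ^ (3 * n) * max M T ^ (2 * k) := by
        rw [← hXpow, mul_pow, mul_pow, ← pow_mul]; ring
    _ ≤ 2 * (64 * K) ^ n * ℓ ^ (3 * n) * (M ^ (2 * k) + T ^ (2 * k)) :=
        mul_le_mul_of_nonneg_left hX (by positivity)
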